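/- Let l ≥ 1 and q ≥ 2 be integers and set n = q(2l+1). Let t ∈ [0,1] and put p = (1−t)·1 + t·ω ∈ P_n. Then the points u_j = p·ω^{j·l·q} for j = 0, 1, …, 2l, together with u_{2l+1} = u_0 = p, form an inscribed equilateral (2l+1)-pointed star based at p, with side length r = 2·sin(πl/(2l+1))·√(4·sin²(π/n)·t² − 4·sin²(π/n)·t + 1). -/

import Mathlib

noncomputable section

/-- The primitive `n`-th root of unity `ω = exp(2πi/n)`. -/
def nroot (n : ℕ) : ℂ := Complex.exp (2 * Real.pi * Complex.I / n)

/-- The boundary of the regular `n`-gon inscribed in the unit circle, as a subset of `ℂ`: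
the union of the closed segments from `ω^j` to `ω^(j+1)` for `j = 0, …, n-1`. -/
def polygon (n : ℕ) : Set ℂ :=
  ⋃ j ∈ Finset.range n, segment ℝ ((nroot n) ^ j) ((nroot n) ^ (j + 1))

/-- The critical scale `r_n`: `2 cos(π/n)` for even `n`,
and `1 + cos(2π/n)/cos(π/n)` for odd `n`. -/
def rpoly (n : ℕ) : ℝ :=
  if Even n then 2 * Real.cos (Real.pi / n)
  else 1 + Real.cos (2 * Real.pi / n) / Real.cos (Real.pi / n)

/-- Arc-length parametrization of the polygon `P_n` by the parameter `t` (normalized so that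
`t ∈ [0,1)` traverses the polygon once counterclockwise, with vertices at `t = j/n`). -/
def polyParam (n : ℕ) (t : ℝ) : ℂ :=
  ((1 - Int.fract (n * t) : ℝ) : ℂ) * (nroot n) ^ (⌊(n : ℝ) * t⌋) +
    ((Int.fract (n * t) : ℝ) : ℂ) * (nroot n) ^ (⌊(n : ℝ) * t⌋ + 1)

/-- The parameter value in `[0,1)` of a point `x ∈ P_n`. -/
def polyArg (n : ℕ) (x : ℂ) : ℝ :=
  sInf {t : ℝ | t ∈ Set.Ico (0 : ℝ) 1 ∧ polyParam n t = x}

/-- The normalized counterclockwise arc distance from `x` to `y` along `P_n`: the length of the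
counterclockwise path along `P_n` from `x` to `y` divided by the total perimeter of `P_n`. -/
def polyDist (n : ℕ) (x y : ℂ) : ℝ := Int.fract (polyArg n y - polyArg n x)

/-- `z` is strictly counterclockwise-between `x` and `y` on `P_n`. -/
def SCCWBtw (n : ℕ) (x z y : ℂ) : Prop :=
  0 < polyDist n x z ∧ polyDist n x z < polyDist n x y

/-- An inscribed equilateral `(2l+1)`-pointed star of side length `r` based at `p ∈ P_n`:
a tuple `(u 0, …, u (2l+1))` of points of `P_n` with `u 0 = u (2l+1) = p`, where consecutive
points are at Euclidean distance `r`, every point of `P_n` strictly counterclockwise-between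
`u i` and `u (i+1)` is at distance `< r` from `u i`, and the total winding number is `l`. -/
def IsStar (n l : ℕ) (r : ℝ) (p : ℂ) (u : ℕ → ℂ) : Prop :=
  u 0 = p ∧ u (2 * l + 1) = p ∧
  (∀ i ≤ 2 * l + 1, u i ∈ polygon n) ∧
  (∀ i ≤ 2 * l, dist (u i) (u (i + 1)) = r) ∧
  (∀ i ≤ 2 * l, ∀ z ∈ polygon n, SCCWBtw n (u i) z (u (i + 1)) → dist (u i) z < r) ∧
  (∑ i ∈ Finset.range (2 * l + 1), polyDist n (u i) (u (i + 1))) = (l : ℝ)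

/-- `x` is a vertex of `P_n`. -/
def IsVertex (n : ℕ) (x : ℂ) : Prop := ∃ j < n, x = (nroot n) ^ j

/-- `x` is the midpoint of an edge of `P_n`. -/
def IsMidpoint (n : ℕ) (x : ℂ) : Prop :=
  ∃ j < n, x = ((nroot n) ^ j + (nroot n) ^ (j + 1)) / 2

end

/-- The point `(1-t)·1 + t·ω` on the first edge of the `n`-gon. -/
noncomputable def edgePoint (n : ℕ) (t : ℝ) : ℂ := ((1 - t : ℝ) : ℂ) + (t : ℂ) * nroot n

theorem nroot_ne_zero (n : ℕ) : nroot n ≠ 0 := Complex.exp_ne_zero _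

theorem nroot_zpow (n : ℕ) (k : ℤ) :
    nroot n ^ k = Complex.exp (((k * (2 * Real.pi / n) : ℝ) : ℂ) * Complex.I) := by
  rw [nroot, ← Complex.exp_int_mul]
  congr 1
  push_cast
  ring

theorem nroot_zpow_re (n : ℕ) (k : ℤ) :
    (nroot n ^ k).re = Real.cos (k * (2 * Real.pi / n)) := by
  rw [nroot_zpow, Complex.exp_ofReal_mul_I_re]

theorem nroot_zpow_im (n : ℕ) (k : ℤ) :
    (nroot n ^ k).im = Real.sin (k * (2 * Real.pi / n)) := by
  rw [nroot_zpow, Complex.exp_ofReal_mul_I_im]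

theorem nroot_re (n : ℕ) : (nroot n).re = Real.cos (2 * Real.pi / n) := by
  simpa using nroot_zpow_re n 1

theorem nroot_im (n : ℕ) : (nroot n).im = Real.sin (2 * Real.pi / n) := by
  simpa using nroot_zpow_im n 1

theorem norm_nroot_zpow (n : ℕ) (k : ℤ) : ‖nroot n ^ k‖ = 1 := by
  rw [nroot_zpow, Complex.norm_exp_ofReal_mul_I]

theorem nroot_zpow_self {n : ℕ} (hn : n ≠ 0) : nroot n ^ (n : ℤ) = 1 := by
  have h : (n : ℝ) ≠ 0 := by exact_mod_cast hn
  rw [nroot_zpow, Int.cast_natCast, mul_div_cancel₀ _ h]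
  push_cast
  exact Complex.exp_two_pi_mul_I

theorem polyParam_eq (n : ℕ) (a : ℝ) :
    polyParam n a = nroot n ^ ⌊(n : ℝ) * a⌋ * edgePoint n (Int.fract (n * a)) := by
  rw [polyParam, edgePoint, zpow_add₀ (nroot_ne_zero n), zpow_one]
  ring

theorem polyParam_add_div {n : ℕ} (hn : n ≠ 0) (a : ℝ) (k : ℤ) :
    polyParam n (a + k / n) = nroot n ^ k * polyParam n a := by
  have h : (n : ℝ) ≠ 0 := by exact_mod_cast hn
  have e : (n : ℝ) * (a + k / n) = n * a + k := by field_simp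
  rw [polyParam_eq, polyParam_eq, e, Int.floor_add_intCast, Int.fract_add_intCast,
    zpow_add₀ (nroot_ne_zero n)]
  ring

theorem polyParam_add_int {n : ℕ} (hn : n ≠ 0) (a : ℝ) (k : ℤ) :
    polyParam n (a + k) = polyParam n a := by
  have h : (n : ℝ) ≠ 0 := by exact_mod_cast hn
  have := polyParam_add_div hn a (n * k)
  rw [zpow_mul, nroot_zpow_self hn, one_zpow, one_mul] at this
  rw [← this]
  congr 2
  push_cast
  field_simp

theorem polyParam_fract {n : ℕ} (hn : n ≠ 0) (a : ℝ) :
    polyParam n (Int.fract a) = polyParam n a := by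
  conv_rhs => rw [← Int.fract_add_floor a, polyParam_add_int hn]

theorem polyParam_div {n : ℕ} (hn : n ≠ 0) {t : ℝ} (ht : t ∈ Set.Icc (0 : ℝ) 1) :
    polyParam n (t / n) = edgePoint n t := by
  have h : (n : ℝ) ≠ 0 := by exact_mod_cast hn
  rw [polyParam_eq, mul_div_cancel₀ _ h]
  rcases ht.2.lt_or_eq with h1 | rfl
  · rw [Int.floor_eq_zero_iff.2 ⟨ht.1, h1⟩, Int.fract_eq_self.2 ⟨ht.1, h1⟩, zpow_zero, one_mul]
  · simp [edgePoint]

theorem polyParam_add_div_of_mem {n : ℕ} (hn : n ≠ 0) {t : ℝ} (ht : t ∈ Set.Icc (0 : ℝ) 1)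
    (k : ℤ) : polyParam n (t / n + k / n) = nroot n ^ k * edgePoint n t := by
  rw [polyParam_add_div hn, polyParam_div hn ht]

theorem polyParam_mem_polygon {n : ℕ} (hn : n ≠ 0) (a : ℝ) : polyParam n a ∈ polygon n := by
  have hn' : (0 : ℝ) < n := by exact_mod_cast Nat.pos_of_ne_zero hn
  rw [← polyParam_fract hn]
  have h0 := Int.fract_nonneg a
  have h1 := Int.fract_lt_one a
  generalize Int.fract a = b at *
  obtain ⟨j, hj⟩ := Int.eq_ofNat_of_zero_le (Int.floor_nonneg.2 (mul_nonneg hn'.le h0))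
  have hjn : j < n := by
    have : ((j : ℤ) : ℝ) ≤ n * b := hj ▸ Int.floor_le _
    have h2 : (j : ℝ) < n := by
      push_cast at this
      nlinarith
    exact_mod_cast h2
  simp only [polygon, Set.mem_iUnion, Finset.mem_range]
  refine ⟨j, hjn, 1 - Int.fract (n * b), Int.fract (n * b), ?_, Int.fract_nonneg _, by ring, ?_⟩
  · linarith [Int.fract_lt_one ((n : ℝ) * b)]
  · rw [polyParam, hj, Complex.real_smul, Complex.real_smul]
    norm_cast

theorem exists_polyParam_eq {n : ℕ} (hn : n ≠ 0) {z : ℂ} (hz : z ∈ polygon n) :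
    ∃ a, polyParam n a = z := by
  simp only [polygon, Set.mem_iUnion, Finset.mem_range] at hz
  obtain ⟨j, -, b, f, hb, hf, hbf, rfl⟩ := hz
  obtain rfl : b = 1 - f := by linarith
  refine ⟨f / n + (j : ℤ) / n, ?_⟩
  rw [polyParam_add_div_of_mem hn ⟨hf, by linarith⟩, edgePoint, Complex.real_smul,
    Complex.real_smul, zpow_natCast]
  ring

theorem cos_lt_cos_of_lt_two_pi_sub {x y : ℝ} (hy : 0 ≤ y) (hxy : y < x)
    (hx : x < 2 * Real.pi - y) : Real.cos x < Real.cos y := by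
  have h := Real.cos_sub_cos x y
  have h1 : 0 < Real.sin ((x + y) / 2) := Real.sin_pos_of_pos_of_lt_pi (by linarith) (by linarith)
  have h2 : 0 < Real.sin ((x - y) / 2) := Real.sin_pos_of_pos_of_lt_pi (by linarith) (by linarith)
  nlinarith [mul_pos h1 h2]

/-- The linear functional whose maximum on the `n`-gon is attained exactly on the first edge. -/
noncomputable def edgeHeight (n : ℕ) (z : ℂ) : ℝ :=
  Real.cos (Real.pi / n) * z.re + Real.sin (Real.pi / n) * z.im

theorem edgeHeight_zpow_mul_edgePoint (n : ℕ) (k : ℤ) (f : ℝ) :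
    edgeHeight n (nroot n ^ k * edgePoint n f) =
      (1 - f) * Real.cos ((2 * k - 1) * (Real.pi / n)) +
        f * Real.cos ((2 * k + 1) * (Real.pi / n)) := by
  have e : nroot n ^ k * edgePoint n f =
      ((1 - f : ℝ) : ℂ) * nroot n ^ k + (f : ℂ) * nroot n ^ (k + 1) := by
    rw [zpow_add₀ (nroot_ne_zero n), zpow_one, edgePoint]
    ring
  have e1 : (2 * (k : ℝ) - 1) * (Real.pi / n) = k * (2 * Real.pi / n) - Real.pi / n := by ring
  have e2 : (2 * (k : ℝ) + 1) * (Real.pi / n) = (k + 1) * (2 * Real.pi / n) - Real.pi / n := by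
    ring
  rw [e, edgeHeight, e1, e2, Real.cos_sub, Real.cos_sub]
  simp only [Complex.add_re, Complex.add_im, Complex.re_ofReal_mul, Complex.im_ofReal_mul,
    nroot_zpow_re, nroot_zpow_im]
  push_cast
  ring

theorem edgePoint_injective {n : ℕ} (hn : 3 ≤ n) : Function.Injective (edgePoint n) := by
  intro f g h
  have hn' : (3 : ℝ) ≤ n := by exact_mod_cast hn
  have hs : 0 < Real.sin (2 * Real.pi / n) := by
    apply Real.sin_pos_of_pos_of_lt_pi
    · positivity
    · rw [div_lt_iff₀ (by linarith)]
      nlinarith [Real.pi_pos]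
  have := congrArg Complex.im h
  simp only [edgePoint, Complex.add_im, Complex.ofReal_im, Complex.im_ofReal_mul, nroot_im,
    zero_add] at this
  exact mul_right_cancel₀ hs.ne' this

theorem eq_zero_of_zpow_mul_edgePoint_eq {n : ℕ} (hn : 3 ≤ n) {d : ℤ} (hd : 0 ≤ d) (hdn : d < n)
    {f g : ℝ} (hf : f ∈ Set.Ico (0 : ℝ) 1) (hg : g ∈ Set.Ico (0 : ℝ) 1)
    (h : nroot n ^ d * edgePoint n f = edgePoint n g) : d = 0 := by
  have hn' : (3 : ℝ) ≤ n := by exact_mod_cast hn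
  by_contra hd0
  have hθ : 0 < Real.pi / n := by positivity
  have hnθ : n * (Real.pi / n) = Real.pi := by field_simp
  have hdn' : (d : ℝ) + 1 ≤ n := by exact_mod_cast hdn
  have H := edgeHeight_zpow_mul_edgePoint n d f
  have H0 := edgeHeight_zpow_mul_edgePoint n 0 g
  rw [h] at H
  rw [zpow_zero, one_mul, H] at H0
  have e1 : (2 * ((0 : ℤ) : ℝ) - 1) * (Real.pi / n) = -(Real.pi / n) := by push_cast; ring
  have e2 : (2 * ((0 : ℤ) : ℝ) + 1) * (Real.pi / n) = Real.pi / n := by push_cast; ring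
  rw [e1, e2, Real.cos_neg] at H0
  rcases eq_or_lt_of_le (show 1 ≤ d by omega) with rfl | hd2
  · have e3 : (2 * ((1 : ℤ) : ℝ) - 1) * (Real.pi / n) = Real.pi / n := by push_cast; ring
    have e4 : (2 * ((1 : ℤ) : ℝ) + 1) * (Real.pi / n) = 3 * (Real.pi / n) := by push_cast; ring
    rw [e3, e4] at H0
    have hlt : Real.cos (3 * (Real.pi / n)) < Real.cos (Real.pi / n) :=
      cos_lt_cos_of_lt_two_pi_sub hθ.le (by linarith) (by nlinarith)
    have hf0 : f = 0 := by
      by_contra hne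
      have : 0 < f := lt_of_le_of_ne hf.1 (Ne.symm hne)
      nlinarith
    have : g = 1 := by
      apply edgePoint_injective hn
      rw [← h, hf0]
      simp [edgePoint]
    exact absurd hg.2 (by simp [this])
  · have hd2' : (2 : ℝ) ≤ d := by exact_mod_cast hd2
    have hlt1 : Real.cos ((2 * d - 1) * (Real.pi / n)) < Real.cos (Real.pi / n) :=
      cos_lt_cos_of_lt_two_pi_sub hθ.le (by nlinarith) (by nlinarith)
    have hle2 : Real.cos ((2 * d + 1) * (Real.pi / n)) ≤ Real.cos (Real.pi / n) := by
      rcases hdn'.lt_or_eq with h3 | h3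
      · have h4 : (d : ℝ) + 1 + 1 ≤ n := by
          have : d + 1 < n := by exact_mod_cast h3
          exact_mod_cast this
        exact (cos_lt_cos_of_lt_two_pi_sub hθ.le (by nlinarith) (by nlinarith)).le
      · have : (2 * (d : ℝ) + 1) * (Real.pi / n) = 2 * Real.pi - Real.pi / n := by
          rw [show (2 * (d : ℝ) + 1) = 2 * n - 1 by linarith]
          linarith
        rw [this, Real.cos_two_pi_sub]
    nlinarith [hf.1, hf.2]

theorem polyParam_injOn {n : ℕ} (hn : 3 ≤ n) : Set.InjOn (polyParam n) (Set.Ico 0 1) := by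
  have hn' : (0 : ℝ) < n := by exact_mod_cast (show 0 < n by omega)
  have floor_lt : ∀ x ∈ Set.Ico (0 : ℝ) 1, ⌊(n : ℝ) * x⌋ < n := fun x hx => by
    rw [Int.floor_lt]
    push_cast
    nlinarith [hx.2]
  have floor_nonneg : ∀ x ∈ Set.Ico (0 : ℝ) 1, 0 ≤ ⌊(n : ℝ) * x⌋ := fun x hx =>
    Int.floor_nonneg.2 (mul_nonneg hn'.le hx.1)
  have fract_mem : ∀ x : ℝ, Int.fract x ∈ Set.Ico (0 : ℝ) 1 := fun x =>
    ⟨Int.fract_nonneg x, Int.fract_lt_one x⟩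
  have key : ∀ x ∈ Set.Ico (0 : ℝ) 1, ∀ y ∈ Set.Ico (0 : ℝ) 1,
      ⌊(n : ℝ) * y⌋ ≤ ⌊(n : ℝ) * x⌋ → polyParam n x = polyParam n y → x = y := by
    intro x hx y hy hle h
    rw [polyParam_eq, polyParam_eq] at h
    have h' : nroot n ^ (⌊(n : ℝ) * x⌋ - ⌊(n : ℝ) * y⌋) * edgePoint n (Int.fract (n * x)) =
        edgePoint n (Int.fract (n * y)) := by
      have h0 := zpow_ne_zero ⌊(n : ℝ) * y⌋ (nroot_ne_zero n)
      rw [zpow_sub₀ (nroot_ne_zero n), div_mul_eq_mul_div, h, mul_div_cancel_left₀ _ h0]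
    have hd := eq_zero_of_zpow_mul_edgePoint_eq hn (sub_nonneg.2 hle)
      (by linarith [floor_lt x hx, floor_nonneg y hy]) (fract_mem _) (fract_mem _) h'
    rw [hd, zpow_zero, one_mul] at h'
    have hfr := edgePoint_injective hn h'
    have hxy : (n : ℝ) * x = n * y := by
      rw [← Int.floor_add_fract ((n : ℝ) * x), ← Int.floor_add_fract ((n : ℝ) * y), hfr,
        sub_eq_zero.1 hd]
    exact mul_left_cancel₀ hn'.ne' hxy
  intro x hx y hy h
  rcases le_total ⌊(n : ℝ) * y⌋ ⌊(n : ℝ) * x⌋ with hle | hle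
  · exact key x hx y hy hle h
  · exact (key y hy x hx hle h.symm).symm

theorem polyArg_polyParam {n : ℕ} (hn : 3 ≤ n) (a : ℝ) :
    polyArg n (polyParam n a) = Int.fract a := by
  have hmem : Int.fract a ∈ Set.Ico (0 : ℝ) 1 := ⟨Int.fract_nonneg a, Int.fract_lt_one a⟩
  have hfr := polyParam_fract (show n ≠ 0 by omega) a
  have : {t : ℝ | t ∈ Set.Ico (0 : ℝ) 1 ∧ polyParam n t = polyParam n a} = {Int.fract a} := by
    ext s
    constructor
    · rintro ⟨hs, h⟩
      exact polyParam_injOn hn hs hmem (h.trans hfr.symm)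
    · rintro rfl
      exact ⟨hmem, hfr⟩
  rw [polyArg, this, csInf_singleton]

theorem polyDist_polyParam {n : ℕ} (hn : 3 ≤ n) (a b : ℝ) :
    polyDist n (polyParam n a) (polyParam n b) = Int.fract (b - a) := by
  rw [polyDist, polyArg_polyParam hn, polyArg_polyParam hn, Int.fract_eq_fract]
  refine ⟨⌊a⌋ - ⌊b⌋, ?_⟩
  rw [Int.fract, Int.fract]
  push_cast
  ring

theorem sq_norm_edgePoint (n : ℕ) (t : ℝ) :
    ‖edgePoint n t‖ ^ 2 = 1 - 2 * t * (1 - t) * (1 - Real.cos (2 * Real.pi / n)) := by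
  rw [Complex.sq_norm, Complex.normSq_apply]
  simp only [edgePoint, Complex.add_re, Complex.add_im, Complex.re_ofReal_mul,
    Complex.im_ofReal_mul, Complex.ofReal_re, Complex.ofReal_im, nroot_re, nroot_im]
  linear_combination t ^ 2 * Real.sin_sq_add_cos_sq (2 * Real.pi / n)

theorem sq_norm_one_sub_nroot_zpow (n : ℕ) (k : ℤ) :
    ‖1 - nroot n ^ k‖ ^ 2 = 2 - 2 * Real.cos (k * (2 * Real.pi / n)) := by
  rw [Complex.sq_norm, Complex.normSq_apply]
  simp only [Complex.sub_re, Complex.sub_im, Complex.one_re, Complex.one_im, nroot_zpow_re,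
    nroot_zpow_im]
  linear_combination Real.sin_sq_add_cos_sq (k * (2 * Real.pi / n))

theorem sq_norm_edgePoint_sub_nroot_zpow (n : ℕ) (t : ℝ) (k : ℤ) :
    ‖edgePoint n t - nroot n ^ k‖ ^ 2 = ‖edgePoint n t‖ ^ 2 + 1 -
      2 * ((1 - t) * Real.cos (k * (2 * Real.pi / n)) +
        t * Real.cos ((k - 1) * (2 * Real.pi / n))) := by
  rw [Complex.sq_norm, Complex.normSq_apply, Complex.sq_norm, Complex.normSq_apply,
    show ((k : ℝ) - 1) * (2 * Real.pi / n) = k * (2 * Real.pi / n) - 2 * Real.pi / n by ring,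
    Real.cos_sub]
  simp only [edgePoint, Complex.sub_re, Complex.sub_im, Complex.add_re, Complex.add_im,
    Complex.re_ofReal_mul, Complex.im_ofReal_mul, Complex.ofReal_re, Complex.ofReal_im,
    nroot_re, nroot_im, nroot_zpow_re, nroot_zpow_im]
  linear_combination Real.sin_sq_add_cos_sq (k * (2 * Real.pi / n))

theorem norm_edgePoint_sub_nroot_zpow_lt_succ {n : ℕ} (hn : 3 ≤ n) {t : ℝ}
    (ht : t ∈ Set.Icc (0 : ℝ) 1) {k : ℤ} (hk : 1 ≤ k) (hkn : 2 * (k + 1) ≤ n) :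
    ‖edgePoint n t - nroot n ^ k‖ < ‖edgePoint n t - nroot n ^ (k + 1)‖ := by
  have hn' : (3 : ℝ) ≤ n := by exact_mod_cast hn
  have hk' : (1 : ℝ) ≤ k := by exact_mod_cast hk
  have hkn' : 2 * ((k : ℝ) + 1) ≤ n := by exact_mod_cast hkn
  have hθ : 0 < 2 * Real.pi / n := by positivity
  have hnθ : n * (2 * Real.pi / n) = 2 * Real.pi := by field_simp
  apply lt_of_pow_lt_pow_left₀ 2 (norm_nonneg _)
  rw [sq_norm_edgePoint_sub_nroot_zpow, sq_norm_edgePoint_sub_nroot_zpow]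
  push_cast
  have h1 : Real.cos (((k : ℝ) + 1) * (2 * Real.pi / n)) < Real.cos (k * (2 * Real.pi / n)) :=
    Real.cos_lt_cos_of_nonneg_of_le_pi (by positivity) (by nlinarith) (by nlinarith)
  have h2 : Real.cos (((k : ℝ) + 1 - 1) * (2 * Real.pi / n)) <
      Real.cos ((k - 1) * (2 * Real.pi / n)) :=
    Real.cos_lt_cos_of_nonneg_of_le_pi (mul_nonneg (by linarith) hθ.le) (by nlinarith)
      (by nlinarith)
  rcases ht.1.eq_or_lt with rfl | h0
  · linarith
  · nlinarith [mul_pos h0 (sub_pos.2 h2), mul_nonneg (sub_nonneg.2 ht.2) (sub_pos.2 h1).le]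

theorem norm_edgePoint_sub_nroot_zpow_mono {n : ℕ} (hn : 3 ≤ n) {t : ℝ}
    (ht : t ∈ Set.Icc (0 : ℝ) 1) {k m : ℤ} (hk : 1 ≤ k) (hkm : k ≤ m) (hm : 2 * m ≤ n) :
    ‖edgePoint n t - nroot n ^ k‖ ≤ ‖edgePoint n t - nroot n ^ m‖ := by
  induction m, hkm using Int.leInduction with
  | base => exact le_rfl
  | succ j hj ih =>
    exact (ih (by omega)).trans
      (norm_edgePoint_sub_nroot_zpow_lt_succ hn ht (by omega) hm).le

theorem norm_edgePoint_sub_nroot_zpow_lt {n : ℕ} (hn : 3 ≤ n) {t : ℝ}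
    (ht : t ∈ Set.Ioc (0 : ℝ) 1) {m : ℤ} (hnm : n < 4 * m) (hmn : 2 * (m + 1) ≤ n) :
    ‖edgePoint n t - nroot n ^ m‖ < ‖edgePoint n t‖ * ‖1 - nroot n ^ m‖ := by
  have hn' : (3 : ℝ) ≤ n := by exact_mod_cast hn
  have hnm' : (n : ℝ) < 4 * m := by exact_mod_cast hnm
  have hmn' : 2 * ((m : ℝ) + 1) ≤ n := by exact_mod_cast hmn
  have hm0 : (0 : ℝ) < m := by linarith
  have hh : 0 < Real.pi / n := by positivity
  have hnh : n * (Real.pi / n) = Real.pi := by field_simp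
  apply lt_of_pow_lt_pow_left₀ 2 (by positivity)
  rw [mul_pow, sq_norm_edgePoint_sub_nroot_zpow, sq_norm_edgePoint, sq_norm_one_sub_nroot_zpow,
    show ((m : ℝ) - 1) * (2 * Real.pi / n) = 2 * (m * (Real.pi / n)) - 2 * (Real.pi / n) by ring,
    show (m : ℝ) * (2 * Real.pi / n) = 2 * (m * (Real.pi / n)) by ring,
    show 2 * Real.pi / (n : ℝ) = 2 * (Real.pi / n) by ring, Real.cos_sub]
  have hφ : 0 < m * (Real.pi / n) := by positivity
  have hφ4 : Real.pi < 4 * (m * (Real.pi / n)) := by nlinarith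
  have hφh : 2 * (m * (Real.pi / n) + Real.pi / n) ≤ Real.pi := by nlinarith
  generalize (m : ℝ) * (Real.pi / n) = φ at *
  generalize Real.pi / (n : ℝ) = h at *
  have hC : Real.cos (2 * φ) < 0 :=
    Real.cos_neg_of_pi_div_two_lt_of_lt (by linarith) (by linarith)
  have hS : 0 < Real.sin (2 * φ) := Real.sin_pos_of_pos_of_lt_pi (by linarith) (by linarith)
  have hs : 0 < Real.sin (2 * h) := Real.sin_pos_of_pos_of_lt_pi (by linarith) (by linarith)
  have ha : 0 ≤ 1 - Real.cos (2 * h) := by linarith [Real.cos_le_one (2 * h)]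
  have hX1 : 0 < Real.sin (2 * φ) * Real.sin (2 * h) -
      (1 - Real.cos (2 * h)) * Real.cos (2 * φ) := by nlinarith [mul_pos hS hs]
  have hX0 : 0 ≤ Real.sin (2 * φ) * Real.sin (2 * h) -
      (1 - Real.cos (2 * h)) * (1 - Real.cos (2 * φ)) := by
    have e : Real.sin (2 * φ) * Real.sin (2 * h) -
        (1 - Real.cos (2 * h)) * (1 - Real.cos (2 * φ)) =
        4 * (Real.sin φ * Real.sin h * Real.cos (φ + h)) := by
      rw [Real.cos_add, Real.sin_two_mul, Real.sin_two_mul, Real.cos_two_mul, Real.cos_two_mul,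
        Real.cos_sq', Real.cos_sq']
      ring
    rw [e]
    have h1 : 0 ≤ Real.sin φ := Real.sin_nonneg_of_nonneg_of_le_pi (by linarith) (by linarith)
    have h2 : 0 ≤ Real.sin h := Real.sin_nonneg_of_nonneg_of_le_pi (by linarith) (by linarith)
    have h3 : 0 ≤ Real.cos (φ + h) := Real.cos_nonneg_of_mem_Icc ⟨by linarith, by linarith⟩
    positivity
  have hpos := mul_pos ht.1 (add_pos_of_nonneg_of_pos (mul_nonneg (sub_nonneg.2 ht.2) hX0)
    (mul_pos ht.1 hX1))
  nlinarith

theorem norm_edgePoint_sub_nroot_zpow_le {n : ℕ} (hn : 3 ≤ n) {t : ℝ}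
    (ht : t ∈ Set.Icc (0 : ℝ) 1) {m : ℤ} (hnm : n < 4 * m) (hmn : 2 * (m + 1) ≤ n) :
    ‖edgePoint n t - nroot n ^ m‖ ≤ ‖edgePoint n t‖ * ‖1 - nroot n ^ m‖ := by
  rcases ht.1.eq_or_lt with rfl | h0
  · simp [edgePoint]
  · exact (norm_edgePoint_sub_nroot_zpow_lt hn ⟨h0, ht.2⟩ hnm hmn).le

theorem norm_edgePoint_sub_zpow_mul_edgePoint_lt {n : ℕ} (hn : 3 ≤ n) {t f : ℝ}
    (ht : t ∈ Set.Icc (0 : ℝ) 1) (hf : f ∈ Set.Ico (0 : ℝ) 1) {k m : ℤ} (hnm : n < 4 * m)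
    (hmn : 2 * (m + 1) ≤ n) (h1 : t < k + f) (h2 : k + f < t + m) :
    ‖edgePoint n t - nroot n ^ k * edgePoint n f‖ <
      ‖edgePoint n t‖ * ‖1 - nroot n ^ m‖ := by
  have hk0 : 0 ≤ k := by
    have : (-1 : ℝ) < k := by linarith [ht.1, hf.2]
    have : -1 < k := by exact_mod_cast this
    omega
  have hkm : k ≤ m := by
    have : (k : ℝ) < m + 1 := by linarith [ht.2, hf.1]
    have : k < m + 1 := by exact_mod_cast this
    omega
  have hV := norm_edgePoint_sub_nroot_zpow_le hn ht hnm hmn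
  rcases hkm.eq_or_lt with rfl | hkm
  · have hft : f < t := by linarith
    have ht0 : 0 < t := hf.1.trans_lt hft
    have hlt := norm_edgePoint_sub_nroot_zpow_lt hn ⟨ht0, ht.2⟩ hnm hmn
    have ht0' : (t : ℂ) ≠ 0 := by exact_mod_cast ht0.ne'
    have e : edgePoint n t - nroot n ^ k * edgePoint n f =
        ((1 - f / t : ℝ) : ℂ) * (edgePoint n t - nroot n ^ k) +
          ((f / t : ℝ) : ℂ) * (edgePoint n t * (1 - nroot n ^ k)) := by
      simp only [edgePoint]
      push_cast
      field_simp
      ring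
    have hq0 : 0 ≤ f / t := div_nonneg hf.1 ht0.le
    have hq1 : f / t < 1 := (div_lt_one ht0).2 hft
    rw [e]
    refine (norm_add_le _ _).trans_lt ?_
    rw [norm_mul, norm_mul, norm_mul, Complex.norm_of_nonneg (by linarith),
      Complex.norm_of_nonneg hq0]
    nlinarith
  · rcases hk0.eq_or_lt with rfl | hk0
    · have hft : t < f := by simpa using h1
      have e : edgePoint n t - nroot n ^ (0 : ℤ) * edgePoint n f =
          ((f - t : ℝ) : ℂ) * (1 - nroot n) := by
        simp only [edgePoint, zpow_zero]
        push_cast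
        ring
      have e1 : edgePoint n t - nroot n ^ (1 : ℤ) = ((1 - t : ℝ) : ℂ) * (1 - nroot n) := by
        simp only [edgePoint, zpow_one]
        push_cast
        ring
      have hpos : 0 < ‖1 - nroot n‖ := by
        rw [norm_pos_iff, sub_ne_zero]
        intro h
        exact one_ne_zero (edgePoint_injective hn (a₁ := 1) (a₂ := 0) (by simp [edgePoint, ← h]))
      have hmono := norm_edgePoint_sub_nroot_zpow_mono hn ht le_rfl
        (show (1 : ℤ) ≤ m by omega) (by omega)
      rw [e1, norm_mul, Complex.norm_of_nonneg (by linarith [ht.2])] at hmono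
      rw [e, norm_mul, Complex.norm_of_nonneg (by linarith)]
      nlinarith [hf.2]
    · have hlt := norm_edgePoint_sub_nroot_zpow_lt_succ hn ht (show 1 ≤ k by omega) (by omega)
      have hmono := norm_edgePoint_sub_nroot_zpow_mono hn ht (show 1 ≤ k + 1 by omega)
        (show k + 1 ≤ m by omega) (by omega)
      have e : edgePoint n t - nroot n ^ k * edgePoint n f =
          ((1 - f : ℝ) : ℂ) * (edgePoint n t - nroot n ^ k) +
            (f : ℂ) * (edgePoint n t - nroot n ^ (k + 1)) := by
        rw [zpow_add₀ (nroot_ne_zero n), zpow_one]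
        simp only [edgePoint]
        push_cast
        ring
      rw [e]
      refine (norm_add_le _ _).trans_lt ?_
      rw [norm_mul, norm_mul, Complex.norm_of_nonneg (by linarith [hf.2]),
        Complex.norm_of_nonneg hf.1]
      nlinarith [hf.1, hf.2]

theorem norm_polyParam_sub_lt {n : ℕ} (hn : 3 ≤ n) {t δ : ℝ} (ht : t ∈ Set.Icc (0 : ℝ) 1)
    {m : ℤ} (hnm : n < 4 * m) (hmn : 2 * (m + 1) ≤ n) (k : ℤ) (hδ : 0 < δ) (hδm : δ < m / n) :
    ‖polyParam n (t / n + k / n) - polyParam n (t / n + k / n + δ)‖ <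
      ‖edgePoint n t‖ * ‖1 - nroot n ^ m‖ := by
  have hn0 : n ≠ 0 := by omega
  have hn' : (0 : ℝ) < n := by exact_mod_cast Nat.pos_of_ne_zero hn0
  have hδm' : n * δ < m := by
    rwa [lt_div_iff₀ hn', mul_comm] at hδm
  have e : t / n + k / n + δ = (t / n + δ) + k / n := by ring
  have e' : (n : ℝ) * (t / n + δ) = t + n * δ := by field_simp
  have hfl := Int.floor_add_fract (t + n * δ)
  rw [e, polyParam_add_div_of_mem hn0 ht, polyParam_add_div hn0, ← mul_sub, norm_mul,
    norm_nroot_zpow, one_mul, polyParam_eq, e']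
  refine norm_edgePoint_sub_zpow_mul_edgePoint_lt hn ht
    ⟨Int.fract_nonneg _, Int.fract_lt_one _⟩ hnm hmn ?_ ?_
  · rw [hfl]
    nlinarith
  · rw [hfl]
    linarith

theorem norm_edgePoint_mul_norm_one_sub {n : ℕ} {m : ℤ} (t : ℝ) {φ : ℝ}
    (hφ : m * (2 * Real.pi / n) = 2 * φ) (hsin : 0 ≤ Real.sin φ) :
    ‖edgePoint n t‖ * ‖1 - nroot n ^ m‖ = 2 * Real.sin φ *
      Real.sqrt (4 * Real.sin (Real.pi / n) ^ 2 * t ^ 2 -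
        4 * Real.sin (Real.pi / n) ^ 2 * t + 1) := by
  have h1 : ‖edgePoint n t‖ = Real.sqrt (4 * Real.sin (Real.pi / n) ^ 2 * t ^ 2 -
      4 * Real.sin (Real.pi / n) ^ 2 * t + 1) := by
    rw [← Real.sqrt_sq (norm_nonneg _), sq_norm_edgePoint, mul_div_assoc, Real.cos_two_mul,
      Real.cos_sq']
    congr 1
    ring
  have h2 : ‖1 - nroot n ^ m‖ = 2 * Real.sin φ := by
    apply (sq_eq_sq₀ (norm_nonneg _) (by positivity)).1
    rw [sq_norm_one_sub_nroot_zpow, hφ, Real.cos_two_mul, Real.cos_sq']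
    ring
  rw [h1, h2, mul_comm]

/-- Explicit stars when `(2l+1) ∣ n`: for `n = q(2l+1)` with `l ≥ 1`, `q ≥ 2`, `t ∈ [0,1]`
and `p = (1-t)·1 + t·ω`, the points `u j = p·ω^(j·l·q)` (for `j = 0, …, 2l+1`, with
`u (2l+1) = u 0 = p` since `ω^n = 1`) form an inscribed equilateral `(2l+1)`-pointed star
based at `p` of side length `2 sin(πl/(2l+1))·√(4 sin²(π/n) t² − 4 sin²(π/n) t + 1)`. -/
theorem explicit_star_of_dvd (l q : ℕ) (hl : 1 ≤ l) (hq : 2 ≤ q) (n : ℕ)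
    (hn : n = q * (2 * l + 1)) (t : ℝ) (ht : t ∈ Set.Icc (0 : ℝ) 1) :
    IsStar n l
      (2 * Real.sin (Real.pi * l / (2 * l + 1)) *
        Real.sqrt (4 * Real.sin (Real.pi / n) ^ 2 * t ^ 2 -
          4 * Real.sin (Real.pi / n) ^ 2 * t + 1))
      (((1 - t : ℝ) : ℂ) + (t : ℂ) * nroot n)
      (fun j => ((((1 - t : ℝ) : ℂ) + (t : ℂ) * nroot n) * (nroot n) ^ (j * l * q))) := by
  have hn3 : 3 ≤ n := by nlinarith
  have hn0 : n ≠ 0 := by omega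
  have hnR : (n : ℝ) = q * (2 * l + 1) := by exact_mod_cast hn
  have hq0 : (q : ℝ) ≠ 0 := by positivity
  have hl0 : (2 * (l : ℝ) + 1) ≠ 0 := by positivity
  have hlq : 0 < l * q := by positivity
  have hnm : (n : ℤ) < 4 * ((l * q : ℕ) : ℤ) := by
    have : n < 4 * (l * q) := by nlinarith
    exact_mod_cast this
  have hmn : 2 * (((l * q : ℕ) : ℤ) + 1) ≤ n := by
    have : 2 * (l * q + 1) ≤ n := by nlinarith
    exact_mod_cast this
  have hmdiv : (((l * q : ℕ) : ℤ) : ℝ) / n = l / (2 * l + 1) := by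
    rw [hnR]
    push_cast
    field_simp
  have hφ : (((l * q : ℕ) : ℤ) : ℝ) * (2 * Real.pi / n) =
      2 * (Real.pi * l / (2 * l + 1)) := by
    rw [show (((l * q : ℕ) : ℤ) : ℝ) * (2 * Real.pi / n) =
      2 * Real.pi * ((((l * q : ℕ) : ℤ) : ℝ) / n) by ring, hmdiv]
    ring
  have hfrac0 : (0 : ℝ) ≤ l / (2 * l + 1) := by positivity
  have hfrac1 : (l : ℝ) / (2 * l + 1) < 1 := by
    rw [div_lt_one (by positivity)]
    linarith [(Nat.cast_nonneg l : (0 : ℝ) ≤ l)]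
  have hsin : 0 ≤ Real.sin (Real.pi * l / (2 * l + 1)) := by
    rw [mul_div_assoc]
    apply Real.sin_nonneg_of_nonneg_of_le_pi
    · positivity
    · nlinarith [Real.pi_pos]
  rw [← norm_edgePoint_mul_norm_one_sub t hφ hsin]
  have hu : ∀ j : ℕ, (((1 - t : ℝ) : ℂ) + (t : ℂ) * nroot n) * nroot n ^ (j * l * q) =
      polyParam n (t / n + ((j * (l * q : ℕ) : ℤ) : ℝ) / n) := fun j => by
    rw [polyParam_add_div_of_mem hn0 ht, edgePoint, mul_comm, ← zpow_natCast]
    push_cast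
    rw [mul_assoc (j : ℤ)]
  have hstep : ∀ j : ℕ, t / n + (((j + 1 : ℕ) * (l * q : ℕ) : ℤ) : ℝ) / n =
      t / n + ((j * (l * q : ℕ) : ℤ) : ℝ) / n + l / (2 * l + 1) := fun j => by
    rw [← hmdiv]
    push_cast
    ring
  have hdist : ∀ j : ℕ, polyDist n (polyParam n (t / n + ((j * (l * q : ℕ) : ℤ) : ℝ) / n))
      (polyParam n (t / n + (((j + 1 : ℕ) * (l * q : ℕ) : ℤ) : ℝ) / n)) = l / (2 * l + 1) :=
    fun j => by
      rw [polyDist_polyParam hn3, hstep, add_sub_cancel_left,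
        Int.fract_eq_self.2 ⟨hfrac0, hfrac1⟩]
  simp only [IsStar, hu]
  refine ⟨?_, ?_, fun i _ => polyParam_mem_polygon hn0 _, ?_, ?_, ?_⟩
  · simpa [edgePoint] using polyParam_div hn0 ht
  · have e : t / n + (((2 * l + 1 : ℕ) * (l * q : ℕ) : ℤ) : ℝ) / n = t / n + (l : ℤ) := by
      rw [hnR]
      push_cast
      field_simp
    rw [e, polyParam_add_int hn0, polyParam_div hn0 ht, edgePoint]
  · intro i _
    rw [polyParam_add_div_of_mem hn0 ht, polyParam_add_div_of_mem hn0 ht, dist_eq_norm,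
      show (((i + 1 : ℕ) : ℤ) * ((l * q : ℕ) : ℤ)) =
        (i : ℤ) * ((l * q : ℕ) : ℤ) + ((l * q : ℕ) : ℤ) by push_cast; ring,
      zpow_add₀ (nroot_ne_zero n),
      show ∀ a b c : ℂ, a * c - a * b * c = a * (c * (1 - b)) by intros; ring,
      norm_mul, norm_nroot_zpow, one_mul, norm_mul]
  · rintro i - z hz ⟨h1, h2⟩
    rw [hdist] at h2
    obtain ⟨s, rfl⟩ := exists_polyParam_eq hn0 hz
    rw [polyDist_polyParam hn3] at h1 h2
    have hs := norm_polyParam_sub_lt hn3 ht hnm hmn (i * (l * q : ℕ)) h1 (by rwa [hmdiv])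
    have e : ∀ a : ℝ, polyParam n (a + Int.fract (s - a)) = polyParam n s := fun a => by
      rw [← polyParam_add_int hn0 _ ⌊s - a⌋, add_assoc, Int.fract_add_floor, add_sub_cancel]
    rwa [e, ← dist_eq_norm] at hs
  · rw [Finset.sum_congr rfl fun i _ => hdist i, Finset.sum_const, Finset.card_range,
      nsmul_eq_mul]
    push_cast
    field_simp
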